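/- arXiv:1312.2037 — 8 statements merged into one kernel-verified Lean document; each statement's English description precedes it below -/
import Mathlib

section
/- Let a > 0 and s > 0, and let w : ℝ → ℝ be continuous on [0, s] with the function ξ ↦ (1 - w(ξ))/ξ integrable on (0, s]. Define H(t) = ∫_0^t (1 - w(ξ))/ξ dξ for 0 ≤ t ≤ s. Then ∫_0^1 a·x^(a-1)·w(s·x)·exp(−a·H(s·x)) dx = exp(−a·H(s)). (This identity expresses that g(s) = exp(−a·∫_0^s (1−w(ξ))/ξ dξ) is the Laplace transform of the stationary solution of the random difference equation U_n = X_n(Y_n + U_{n−1}), where X_n has density a·x^(a−1) on [0,1] and Y_n has Laplace transform w.) -/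
open MeasureTheory intervalIntegral

/-- The fixed-point identity for the Laplace transform
`g(s) = exp(-a ∫_0^s (1 - w ξ)/ξ dξ)` of the stationary solution of the random
difference equation `Uₙ = Xₙ (Yₙ + Uₙ₋₁)`, where `Xₙ` has density `a x^(a-1)`
on `[0,1]` and `Yₙ` has Laplace transform `w`. -/
theorem stmt_0 (a s : ℝ) (ha : 0 < a) (hs : 0 < s) (w : ℝ → ℝ)
    (hw : ContinuousOn w (Set.Icc 0 s))
    (hint : IntegrableOn (fun ξ => (1 - w ξ) / ξ) (Set.Ioc 0 s)) :
    ∫ x in (0:ℝ)..1, a * x ^ (a - 1) * w (s * x) *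
        Real.exp (-a * ∫ ξ in (0:ℝ)..(s * x), (1 - w ξ) / ξ)
      = Real.exp (-a * ∫ ξ in (0:ℝ)..s, (1 - w ξ) / ξ) := by
  have hcontH : ContinuousOn (fun t => ∫ ξ in (0:ℝ)..t, (1 - w ξ) / ξ) (Set.Icc 0 s) := by
    rw [← Set.uIcc_of_le hs.le]
    refine continuousOn_primitive_interval ?_
    rwa [Set.uIcc_of_le hs.le, integrableOn_Icc_iff_integrableOn_Ioc]
  have hmaps : Set.MapsTo (fun x => s * x) (Set.Icc (0:ℝ) 1) (Set.Icc 0 s) := fun x hx =>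
    ⟨mul_nonneg hs.le hx.1, mul_le_of_le_one_right hs.le hx.2⟩
  have hexp : ContinuousOn
      (fun x => Real.exp (-a * ∫ ξ in (0:ℝ)..(s * x), (1 - w ξ) / ξ)) (Set.Icc 0 1) :=
    Real.continuous_exp.comp_continuousOn
      (continuousOn_const.mul (hcontH.comp (by fun_prop) hmaps))
  have hwcomp : ContinuousOn (fun x => w (s * x)) (Set.Icc 0 1) :=
    hw.comp (by fun_prop) hmaps
  have hderiv : ∀ x ∈ Set.Ioo (0:ℝ) 1, HasDerivAt
      (fun x => x ^ a * Real.exp (-a * ∫ ξ in (0:ℝ)..(s * x), (1 - w ξ) / ξ))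
      (a * x ^ (a - 1) * w (s * x) *
        Real.exp (-a * ∫ ξ in (0:ℝ)..(s * x), (1 - w ξ) / ξ)) x := by
    intro x hx
    have hsx : 0 < s * x := mul_pos hs hx.1
    have hsx' : s * x < s := mul_lt_of_lt_one_right hs hx.2
    have hcont : ContinuousOn (fun ξ => (1 - w ξ) / ξ) (Set.Ioo 0 s) :=
      (continuousOn_const.sub (hw.mono Set.Ioo_subset_Icc_self)).div continuousOn_id
        fun ξ hξ => hξ.1.ne'
    have hH : HasDerivAt (fun t => ∫ ξ in (0:ℝ)..t, (1 - w ξ) / ξ)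
        ((1 - w (s * x)) / (s * x)) (s * x) :=
      integral_hasDerivAt_right
        ((intervalIntegrable_iff_integrableOn_Ioc_of_le hsx.le).2
          (hint.mono_set (Set.Ioc_subset_Ioc_right hsx'.le)))
        (hcont.stronglyMeasurableAtFilter isOpen_Ioo _ ⟨hsx, hsx'⟩)
        (hcont.continuousAt (Ioo_mem_nhds hsx hsx'))
    have hHs := hH.comp x ((hasDerivAt_id x).const_mul s)
    refine ((Real.hasDerivAt_rpow_const (Or.inl hx.1.ne')).mul
      (hHs.const_mul (-a)).exp).congr_deriv ?_
    have hxa : x ^ a = x ^ (a - 1) * x := by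
      rw [← Real.rpow_add_one hx.1.ne', sub_add_cancel]
    have hx0 : x ≠ 0 := hx.1.ne'
    simp only [Function.comp_apply, hxa]
    field_simp
    ring
  have hintegrable : IntervalIntegrable (fun x => a * x ^ (a - 1) * w (s * x) *
      Real.exp (-a * ∫ ξ in (0:ℝ)..(s * x), (1 - w ξ) / ξ)) volume 0 1 := by
    refine (((intervalIntegrable_rpow' (by linarith)).const_mul a).mul_continuousOn
      ?_).mul_continuousOn ?_ <;> rwa [Set.uIcc_of_le zero_le_one]
  rw [integral_eq_sub_of_hasDerivAt_of_le zero_le_one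
    ((continuousOn_id.rpow_const fun _ _ => Or.inr ha.le).mul hexp) hderiv hintegrable]
  simp [Real.zero_rpow ha.ne']
end

section
/- Let ν(t) = ∫_0^∞ t^x / Γ(x+1) dx for t > 0 (the Volterra ν-function). Then for every real s > 1, ∫_0^∞ e^(−s·t) ν(t) dt = 1/(s · ln s). -/
open MeasureTheory

/-- The Volterra ν-function `ν(t) = ∫_0^∞ t^x / Γ(x+1) dx`. -/
noncomputable def volterraNu (t : ℝ) : ℝ :=
  ∫ x in Set.Ioi (0:ℝ), t ^ x / Real.Gamma (x + 1)

/-- The Laplace transform of `t ^ x / Γ(x+1)` at `s` is `s ^ (-(x+1))`. -/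
lemma integral_exp_mul_rpow_div_Gamma {s x : ℝ} (hs : 0 < s) (hx : 0 < x) :
    ∫ t in Set.Ioi (0:ℝ), Real.exp (-s * t) * (t ^ x / Real.Gamma (x + 1))
      = s⁻¹ * Real.exp (-Real.log s * x) := by
  have hG : Real.Gamma (x + 1) ≠ 0 := (Real.Gamma_pos_of_pos (by linarith)).ne'
  have h := Real.integral_rpow_mul_exp_neg_mul_Ioi (a := x + 1) (r := s) (by linarith) hs
  have hcongr : ∀ t : ℝ, Real.exp (-s * t) * (t ^ x / Real.Gamma (x + 1))
      = (t ^ (x + 1 - 1) * Real.exp (-(s * t))) * (Real.Gamma (x + 1))⁻¹ := by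
    intro t
    rw [add_sub_cancel_right, neg_mul]
    ring
  simp_rw [hcongr]
  rw [integral_mul_const, h, mul_assoc, mul_inv_cancel₀ hG, mul_one, one_div,
    Real.inv_rpow hs.le, Real.rpow_add_one hs.ne', mul_inv, Real.rpow_def_of_pos hs,
    ← Real.exp_neg, mul_comm, neg_mul]

/-- The integrand of the iterated integral is integrable on the open quadrant. -/
lemma integrable_exp_mul_rpow_div_Gamma {s : ℝ} (hs : 1 < s) :
    Integrable (Function.uncurry fun t x : ℝ =>
        Real.exp (-s * t) * (t ^ x / Real.Gamma (x + 1)))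
      ((volume.restrict (Set.Ioi (0:ℝ))).prod (volume.restrict (Set.Ioi (0:ℝ)))) := by
  have hs0 : 0 < s := by linarith
  have hmeas : AEStronglyMeasurable (Function.uncurry fun t x : ℝ =>
        Real.exp (-s * t) * (t ^ x / Real.Gamma (x + 1)))
      ((volume.restrict (Set.Ioi (0:ℝ))).prod (volume.restrict (Set.Ioi (0:ℝ)))) := by
    rw [Measure.prod_restrict]
    refine ContinuousOn.aestronglyMeasurable ?_ (measurableSet_Ioi.prod measurableSet_Ioi)
    rintro ⟨t, x⟩ ⟨ht, hx⟩
    simp only [Set.mem_Ioi] at ht hx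
    have hG : ContinuousAt Real.Gamma (x + 1) :=
      (Real.differentiableAt_Gamma fun m => by
        have : (0:ℝ) ≤ m := m.cast_nonneg
        linarith).continuousAt
    have hG' : ContinuousAt (fun p : ℝ × ℝ => Real.Gamma (p.2 + 1)) (t, x) :=
      ContinuousAt.comp (x := (t, x)) (g := Real.Gamma) (f := fun p : ℝ × ℝ => p.2 + 1) hG
        (by fun_prop)
    refine ContinuousAt.continuousWithinAt (ContinuousAt.mul (by fun_prop) ?_)
    exact (continuousAt_fst.rpow continuousAt_snd (Or.inl ht.ne')).div hG'
      (Real.Gamma_pos_of_pos (by linarith)).ne'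
  rw [integrable_prod_iff' hmeas]
  constructor
  · filter_upwards [ae_restrict_mem measurableSet_Ioi] with x hx
    refine Integrable.of_integral_ne_zero ?_
    simp only [Function.uncurry_apply_pair]
    rw [integral_exp_mul_rpow_div_Gamma hs0 hx]
    positivity
  · have hint : IntegrableOn (fun x => s⁻¹ * Real.exp (-Real.log s * x)) (Set.Ioi 0) :=
      (integrableOn_exp_mul_Ioi (neg_lt_zero.mpr (Real.log_pos hs)) 0).const_mul _
    refine hint.congr_fun (fun x hx => ?_) measurableSet_Ioi
    dsimp only
    rw [← integral_exp_mul_rpow_div_Gamma hs0 hx]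
    refine setIntegral_congr_fun measurableSet_Ioi fun t ht => ?_
    have hG := Real.Gamma_pos_of_pos (add_pos hx one_pos)
    have ht' : 0 < t := ht
    have hnonneg : 0 ≤ Real.exp (-s * t) * (t ^ x / Real.Gamma (x + 1)) := by positivity
    exact Real.norm_of_nonneg hnonneg |>.symm

/-- For every `s > 1`, `∫_0^∞ e^(-s t) ν(t) dt = 1/(s log s)`. -/
theorem stmt_4 (s : ℝ) (hs : 1 < s) :
    ∫ t in Set.Ioi (0:ℝ), Real.exp (-s * t) * volterraNu t
      = 1 / (s * Real.log s) := by
  simp_rw [volterraNu, ← integral_const_mul]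
  rw [integral_integral_swap (integrable_exp_mul_rpow_div_Gamma hs),
    setIntegral_congr_fun measurableSet_Ioi fun x hx =>
      integral_exp_mul_rpow_div_Gamma (by linarith) hx,
    integral_const_mul, integral_exp_mul_Ioi (neg_lt_zero.mpr (Real.log_pos hs))]
  rw [mul_zero, Real.exp_zero, neg_div_neg_eq, one_div, one_div, mul_inv]
end

section
/- Let β > −1 and define the Volterra function μ(t, β) = ∫_0^∞ t^x · x^β / (Γ(β+1) · Γ(x+1)) dx for t > 0. Then for every real s > 1, ∫_0^∞ e^(−s·t) μ(t, β) dt = 1/(s · (ln s)^(β+1)). -/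
open MeasureTheory

/-- The Volterra function `μ(t, β) = ∫_0^∞ t^x x^β / (Γ(β+1) Γ(x+1)) dx`. -/
noncomputable def volterraMu (t β : ℝ) : ℝ :=
  ∫ x in Set.Ioi (0:ℝ), t ^ x * x ^ β / (Real.Gamma (β + 1) * Real.Gamma (x + 1))

/-- The integrand of the Laplace transform of `volterraMu`, as a function of `(t, x)`. -/
noncomputable def volterraKernel (β s t x : ℝ) : ℝ :=
  Real.exp (-s * t) * (t ^ x * x ^ β / (Real.Gamma (β + 1) * Real.Gamma (x + 1)))

theorem integral_rpow_mul_exp_neg_mul {a r : ℝ} (ha : -1 < a) (hr : 0 < r) :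
    ∫ t in Set.Ioi (0:ℝ), t ^ a * Real.exp (-(r * t)) = (1 / r) ^ (a + 1) * Real.Gamma (a + 1) := by
  simpa using Real.integral_rpow_mul_exp_neg_mul_Ioi (a := a + 1) (by linarith) hr

theorem integrableOn_rpow_mul_exp_neg_mul {a r : ℝ} (ha : -1 < a) (hr : 0 < r) :
    IntegrableOn (fun t : ℝ => t ^ a * Real.exp (-(r * t))) (Set.Ioi 0) := by
  refine not_imp_comm.1 integral_undef ?_
  rw [integral_rpow_mul_exp_neg_mul ha hr]
  have := Real.Gamma_pos_of_pos (show 0 < a + 1 by linarith)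
  positivity

theorem volterraKernel_eq (β s t x : ℝ) :
    volterraKernel β s t x =
      x ^ β / (Real.Gamma (β + 1) * Real.Gamma (x + 1)) * (t ^ x * Real.exp (-(s * t))) := by
  rw [volterraKernel, neg_mul]
  ring

theorem volterraKernel_nonneg {β s t x : ℝ} (hβ : -1 < β) (ht : 0 < t) (hx : 0 < x) :
    0 ≤ volterraKernel β s t x := by
  have := Real.Gamma_pos_of_pos (show 0 < β + 1 by linarith)
  have := Real.Gamma_pos_of_pos (show 0 < x + 1 by linarith)
  unfold volterraKernel
  positivity

theorem integrableOn_volterraKernel (β : ℝ) {s x : ℝ} (hs : 0 < s) (hx : 0 < x) :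
    IntegrableOn (fun t => volterraKernel β s t x) (Set.Ioi 0) := by
  simp_rw [volterraKernel_eq]
  exact (integrableOn_rpow_mul_exp_neg_mul (by linarith) hs).const_mul _

theorem integral_volterraKernel (β : ℝ) {s x : ℝ} (hs : 0 < s) (hx : 0 < x) :
    ∫ t in Set.Ioi (0:ℝ), volterraKernel β s t x =
      1 / (s * Real.Gamma (β + 1)) * (x ^ β * Real.exp (-(Real.log s * x))) := by
  simp_rw [volterraKernel_eq]
  rw [integral_const_mul, integral_rpow_mul_exp_neg_mul (by linarith) hs]
  have hG := (Real.Gamma_pos_of_pos (show 0 < x + 1 by linarith)).ne'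
  have hexp : (1 / s) ^ (x + 1) = 1 / s * Real.exp (-(Real.log s * x)) := by
    rw [Real.rpow_add_one (by positivity), Real.rpow_def_of_pos (by positivity), one_div,
      Real.log_inv, neg_mul, mul_comm]
  rw [hexp]
  field_simp

theorem aestronglyMeasurable_volterraKernel (β s : ℝ) :
    AEStronglyMeasurable (Function.uncurry (volterraKernel β s))
      ((volume.restrict (Set.Ioi 0)).prod (volume.restrict (Set.Ioi 0))) := by
  rw [Measure.prod_restrict]
  refine ContinuousOn.aestronglyMeasurable ?_ (measurableSet_Ioi.prod measurableSet_Ioi)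
  rintro ⟨t, x⟩ ⟨ht, hx⟩
  simp only [Set.mem_Ioi] at ht hx
  have hΓ : ContinuousAt (fun p : ℝ × ℝ => Real.Gamma (p.2 + 1)) (t, x) := by
    refine ContinuousAt.comp (g := Real.Gamma) (f := fun p : ℝ × ℝ => p.2 + 1) ?_ (by fun_prop)
    refine (Real.differentiableAt_Gamma fun m => ?_).continuousAt
    have : (0:ℝ) ≤ m := m.cast_nonneg
    dsimp only
    linarith
  have hΓpos := (Real.Gamma_pos_of_pos (show 0 < x + 1 by linarith)).ne'
  have hcont : ContinuousAt (fun p : ℝ × ℝ => p.2 ^ β / (Real.Gamma (β + 1)) /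
      Real.Gamma (p.2 + 1) * (p.1 ^ p.2 * Real.exp (-(s * p.1)))) (t, x) := by
    refine ContinuousAt.mul (ContinuousAt.div (ContinuousAt.div_const ?_ _) hΓ hΓpos)
      (ContinuousAt.mul ?_ (by fun_prop))
    · exact continuousAt_snd.rpow_const (Or.inl hx.ne')
    · exact continuousAt_fst.rpow continuousAt_snd (Or.inl ht.ne')
  refine (hcont.congr (Filter.Eventually.of_forall fun p => ?_)).continuousWithinAt
  simp only [Function.uncurry, volterraKernel_eq, div_div]

theorem integrable_volterraKernel {β s : ℝ} (hβ : -1 < β) (hs : 1 < s) :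
    Integrable (Function.uncurry (volterraKernel β s))
      ((volume.restrict (Set.Ioi 0)).prod (volume.restrict (Set.Ioi 0))) := by
  have hs0 : 0 < s := by linarith
  refine (integrable_prod_iff' (aestronglyMeasurable_volterraKernel β s)).2 ⟨?_, ?_⟩
  · filter_upwards [ae_restrict_mem measurableSet_Ioi] with x hx
    exact integrableOn_volterraKernel β hs0 hx
  · refine ((integrableOn_rpow_mul_exp_neg_mul hβ (Real.log_pos hs)).const_mul
      (1 / (s * Real.Gamma (β + 1)))).congr ?_
    filter_upwards [ae_restrict_mem measurableSet_Ioi] with x hx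
    rw [← integral_volterraKernel β hs0 hx]
    refine setIntegral_congr_fun measurableSet_Ioi fun t ht => ?_
    exact (Real.norm_of_nonneg (volterraKernel_nonneg hβ ht hx)).symm

/-- For `β > -1` and every `s > 1`, `∫_0^∞ e^(-s t) μ(t, β) dt = 1/(s (log s)^(β+1))`. -/
theorem stmt_5 (β : ℝ) (hβ : -1 < β) (s : ℝ) (hs : 1 < s) :
    ∫ t in Set.Ioi (0:ℝ), Real.exp (-s * t) * volterraMu t β
      = 1 / (s * Real.log s ^ (β + 1)) := by
  have hs0 : 0 < s := by linarith
  have hlog := Real.log_pos hs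
  have hΓ := (Real.Gamma_pos_of_pos (show 0 < β + 1 by linarith)).ne'
  calc ∫ t in Set.Ioi (0:ℝ), Real.exp (-s * t) * volterraMu t β
      = ∫ t in Set.Ioi (0:ℝ), ∫ x in Set.Ioi (0:ℝ), volterraKernel β s t x := by
        simp_rw [volterraMu, ← integral_const_mul, volterraKernel]
    _ = ∫ x in Set.Ioi (0:ℝ), ∫ t in Set.Ioi (0:ℝ), volterraKernel β s t x :=
        integral_integral_swap (integrable_volterraKernel hβ hs)
    _ = ∫ x in Set.Ioi (0:ℝ),
          1 / (s * Real.Gamma (β + 1)) * (x ^ β * Real.exp (-(Real.log s * x))) :=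
        setIntegral_congr_fun measurableSet_Ioi fun x hx => integral_volterraKernel β hs0 hx
    _ = 1 / (s * Real.log s ^ (β + 1)) := by
        rw [integral_const_mul, integral_rpow_mul_exp_neg_mul hβ hlog,
          Real.div_rpow zero_le_one hlog.le, Real.one_rpow]
        have := (Real.rpow_pos_of_pos hlog (β + 1)).ne'
        field_simp
end

section
/- Let φ(z) = ∫_0^∞ z^a / Γ(a) da for z > 0. Then for all real numbers 0 < c < s, ∫_0^∞ e^(−s·u) · φ(c·u)/u du = 1/ln(s/c). In particular, with c = e^(−(1+γ)) (γ the Euler–Mascheroni constant), the Laplace transform of u ↦ (1/u)·φ(e^(−(1+γ))·u) equals 1/(1 + γ + ln s) for s > e^(−(1+γ)). -/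
open MeasureTheory

/-- The Fransén–Wrigge function `φ(z) = ∫_0^∞ z^a / Γ(a) da`. -/
noncomputable def fransenWrigge (z : ℝ) : ℝ :=
  ∫ a in Set.Ioi (0:ℝ), z ^ a / Real.Gamma a

/-- The Mellin-type integrand `(a, u) ↦ e^(-s u) ((c u)^a / Γ(a)) / u`, rewritten as a Gamma
integrand in `u`. -/
theorem exp_mul_rpow_div_Gamma_div_eq {c u : ℝ} (hc : 0 < c) (hu : 0 < u) (s a : ℝ) :
    Real.exp (-s * u) * ((c * u) ^ a / Real.Gamma a) / u
      = c ^ a / Real.Gamma a * (u ^ (a - 1) * Real.exp (-(s * u))) := by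
  rw [Real.mul_rpow hc.le hu.le, Real.rpow_sub_one hu.ne', neg_mul]
  ring

theorem integrableOn_exp_mul_rpow_div_Gamma_div {c s a : ℝ} (hc : 0 < c) (hs : 0 < s)
    (ha : 0 < a) :
    IntegrableOn (fun u => Real.exp (-s * u) * ((c * u) ^ a / Real.Gamma a) / u)
      (Set.Ioi 0) := by
  have h : IntegrableOn (fun u : ℝ => u ^ (a - 1) * Real.exp (-(s * u))) (Set.Ioi 0) := by
    simpa using integrableOn_rpow_mul_exp_neg_mul_rpow
      (by linarith : -1 < a - 1) one_pos hs
  exact IntegrableOn.congr_fun (h.const_mul (c ^ a / Real.Gamma a))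
    (fun u hu => (exp_mul_rpow_div_Gamma_div_eq hc hu s a).symm) measurableSet_Ioi

theorem integral_exp_mul_rpow_div_Gamma_div {c s a : ℝ} (hc : 0 < c) (hs : 0 < s)
    (ha : 0 < a) :
    ∫ u in Set.Ioi (0:ℝ), Real.exp (-s * u) * ((c * u) ^ a / Real.Gamma a) / u
      = (c / s) ^ a := by
  rw [setIntegral_congr_fun measurableSet_Ioi
      (fun u hu => exp_mul_rpow_div_Gamma_div_eq hc hu s a),
    integral_const_mul, Real.integral_rpow_mul_exp_neg_mul_Ioi ha hs,
    div_eq_mul_one_div c s, Real.mul_rpow hc.le (by positivity)]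
  have := (Real.Gamma_pos_of_pos ha).ne'
  field_simp

theorem continuousOn_exp_mul_rpow_div_Gamma_div {c : ℝ} (hc : 0 < c) (s : ℝ) :
    ContinuousOn
      (fun p : ℝ × ℝ => Real.exp (-s * p.2) * ((c * p.2) ^ p.1 / Real.Gamma p.1) / p.2)
      (Set.Ioi 0 ×ˢ Set.Ioi 0) := by
  rintro ⟨a, u⟩ ⟨ha, hu⟩
  simp only [Set.mem_Ioi] at ha hu
  have hΓ : ContinuousAt (fun p : ℝ × ℝ => Real.Gamma p.1) (a, u) :=
    ContinuousAt.comp (g := Real.Gamma) (f := Prod.fst)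
      (Real.differentiableAt_Gamma fun m => by
        have : (0:ℝ) ≤ m := m.cast_nonneg
        dsimp only
        linarith).continuousAt continuousAt_fst
  have hpow : ContinuousAt (fun p : ℝ × ℝ => (c * p.2) ^ p.1) (a, u) :=
    ContinuousAt.rpow (by fun_prop) (by fun_prop) (Or.inl (mul_pos hc hu).ne')
  exact ((ContinuousAt.mul (by fun_prop)
    (hpow.div hΓ (Real.Gamma_pos_of_pos ha).ne')).div
      continuousAt_snd hu.ne').continuousWithinAt

theorem integrableOn_rpow_Ioi_of_lt_one {x : ℝ} (hx : 0 < x) (hx1 : x < 1) :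
    IntegrableOn (fun a : ℝ => x ^ a) (Set.Ioi 0) := by
  simp_rw [Real.rpow_def_of_pos hx]
  exact integrableOn_exp_mul_Ioi (Real.log_neg hx hx1) 0

theorem integral_rpow_Ioi_of_lt_one {x : ℝ} (hx : 0 < x) (hx1 : x < 1) :
    ∫ a in Set.Ioi (0:ℝ), x ^ a = -1 / Real.log x := by
  simp_rw [Real.rpow_def_of_pos hx]
  rw [integral_exp_mul_Ioi (Real.log_neg hx hx1) 0]
  simp

theorem integrable_exp_mul_rpow_div_Gamma_div {c s : ℝ} (hc : 0 < c) (hcs : c < s) :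
    Integrable
      (Function.uncurry fun a u : ℝ =>
        Real.exp (-s * u) * ((c * u) ^ a / Real.Gamma a) / u)
      ((volume.restrict (Set.Ioi 0)).prod (volume.restrict (Set.Ioi 0))) := by
  have hs : 0 < s := hc.trans hcs
  have hmeas : AEStronglyMeasurable
      (Function.uncurry fun a u : ℝ =>
        Real.exp (-s * u) * ((c * u) ^ a / Real.Gamma a) / u)
      ((volume.restrict (Set.Ioi 0)).prod (volume.restrict (Set.Ioi 0))) := by
    rw [Measure.prod_restrict]
    exact (continuousOn_exp_mul_rpow_div_Gamma_div hc s).aestronglyMeasurable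
      (measurableSet_Ioi.prod measurableSet_Ioi)
  refine (integrable_prod_iff hmeas).2 ⟨?_, ?_⟩
  · filter_upwards [ae_restrict_mem measurableSet_Ioi] with a ha
    exact integrableOn_exp_mul_rpow_div_Gamma_div hc hs ha
  · refine (integrableOn_rpow_Ioi_of_lt_one (div_pos hc hs)
      ((div_lt_one hs).2 hcs)).congr_fun (fun a ha => ?_) measurableSet_Ioi
    dsimp only
    rw [← integral_exp_mul_rpow_div_Gamma_div hc hs ha]
    refine setIntegral_congr_fun measurableSet_Ioi fun u hu => ?_
    have hΓ := Real.Gamma_pos_of_pos ha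
    simp only [Set.mem_Ioi] at hu
    exact (Real.norm_of_nonneg (by positivity)).symm

/-- The Laplace transform of `u ↦ φ(c u) / u` at `s > c`. -/
theorem integral_exp_mul_fransenWrigge_div {c s : ℝ} (hc : 0 < c) (hcs : c < s) :
    ∫ u in Set.Ioi (0:ℝ), Real.exp (-s * u) * fransenWrigge (c * u) / u
      = 1 / Real.log (s / c) := by
  have hs : 0 < s := hc.trans hcs
  calc ∫ u in Set.Ioi (0:ℝ), Real.exp (-s * u) * fransenWrigge (c * u) / u
      = ∫ u in Set.Ioi (0:ℝ), ∫ a in Set.Ioi (0:ℝ),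
          Real.exp (-s * u) * ((c * u) ^ a / Real.Gamma a) / u := by
        simp only [fransenWrigge, integral_div, integral_const_mul]
    _ = ∫ a in Set.Ioi (0:ℝ), ∫ u in Set.Ioi (0:ℝ),
          Real.exp (-s * u) * ((c * u) ^ a / Real.Gamma a) / u :=
        (integral_integral_swap (integrable_exp_mul_rpow_div_Gamma_div hc hcs)).symm
    _ = ∫ a in Set.Ioi (0:ℝ), (c / s) ^ a :=
        setIntegral_congr_fun measurableSet_Ioi fun a ha =>
          integral_exp_mul_rpow_div_Gamma_div hc hs ha
    _ = 1 / Real.log (s / c) := by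
        rw [integral_rpow_Ioi_of_lt_one (div_pos hc hs) ((div_lt_one hs).2 hcs),
          ← inv_div s c, Real.log_inv, neg_div_neg_eq]

/-- For all `0 < c < s`, `∫_0^∞ e^(-s u) φ(c u)/u du = 1/log(s/c)`; in particular,
with `c = e^(-(1+γ))` the Laplace transform of `u ↦ (1/u) φ(e^(-(1+γ)) u)` equals
`1/(1 + γ + log s)` for `s > e^(-(1+γ))`. -/
theorem stmt_8 :
    (∀ c s : ℝ, 0 < c → c < s →
      ∫ u in Set.Ioi (0:ℝ), Real.exp (-s * u) * fransenWrigge (c * u) / u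
        = 1 / Real.log (s / c)) ∧
    (∀ s : ℝ, Real.exp (-(1 + Real.eulerMascheroniConstant)) < s →
      ∫ u in Set.Ioi (0:ℝ),
          Real.exp (-s * u) *
            fransenWrigge (Real.exp (-(1 + Real.eulerMascheroniConstant)) * u) / u
        = 1 / (1 + Real.eulerMascheroniConstant + Real.log s)) := by
  refine ⟨fun c s hc hcs => integral_exp_mul_fransenWrigge_div hc hcs, fun s hs => ?_⟩
  rw [integral_exp_mul_fransenWrigge_div (Real.exp_pos _) hs,
    Real.log_div ((Real.exp_pos _).trans hs).ne' (Real.exp_ne_zero _), Real.log_exp,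
    sub_neg_eq_add, add_comm]
end

section
/- Let φ(z) = ∫_0^∞ z^a / Γ(a) da for z > 0. Then for every s > 0, ∫_0^∞ e^(−s·u) · e^(−u) · φ(e^(−1)·u)/u du = 1/(1 + ln(1+s)). That is, u ↦ (e^(−u)/u)·φ(e^(−1)u) is the probability density whose Laplace transform is 1/ln(e·(1+s)), the transform of the shot noise with exponentially distributed parameter A (α = 1) and exponentially distributed amplitudes Y (β = 1). -/
open MeasureTheory

section GammaKernel

open Set

lemma continuousOn_Gamma_Ioi : ContinuousOn Real.Gamma (Ioi 0) := fun a ha =>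
  (Real.differentiableAt_Gamma fun m h => by
    have : (0 : ℝ) < a := ha
    have := m.cast_nonneg (α := ℝ)
    linarith).continuousAt.continuousWithinAt

lemma integral_gamma_kernel {r a : ℝ} (hr : 0 < r) (ha : 0 < a) :
    ∫ u in Ioi (0:ℝ), u ^ (a - 1) * Real.exp (-(r * u)) * (Real.exp (-a) / Real.Gamma a)
      = Real.exp (-(1 + Real.log r) * a) := by
  rw [integral_mul_const, Real.integral_rpow_mul_exp_neg_mul_Ioi ha hr, one_div,
    Real.inv_rpow hr.le, Real.rpow_def_of_pos hr, ← Real.exp_neg]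
  have := (Real.Gamma_pos_of_pos ha).ne'
  field_simp
  rw [← Real.exp_add]
  ring_nf

lemma integrable_gamma_kernel {r : ℝ} (hr : 0 < r) (hlog : 0 < 1 + Real.log r) :
    Integrable (fun p : ℝ × ℝ =>
        p.2 ^ (p.1 - 1) * Real.exp (-(r * p.2)) * (Real.exp (-p.1) / Real.Gamma p.1))
      ((volume.restrict (Ioi 0)).prod (volume.restrict (Ioi 0))) := by
  have hmeas : AEStronglyMeasurable (fun p : ℝ × ℝ =>
        p.2 ^ (p.1 - 1) * Real.exp (-(r * p.2)) * (Real.exp (-p.1) / Real.Gamma p.1))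
      ((volume.restrict (Ioi 0)).prod (volume.restrict (Ioi 0))) := by
    rw [Measure.prod_restrict]
    refine ContinuousOn.aestronglyMeasurable ?_ (measurableSet_Ioi.prod measurableSet_Ioi)
    refine ContinuousOn.mul (ContinuousOn.mul ?_ (by fun_prop))
      (ContinuousOn.div (by fun_prop) ?_ ?_)
    · exact ContinuousOn.rpow (by fun_prop) (by fun_prop) fun p hp => Or.inl (ne_of_gt hp.2)
    · exact continuousOn_Gamma_Ioi.comp continuousOn_fst fun p hp => hp.1
    · exact fun p hp => (Real.Gamma_pos_of_pos hp.1).ne'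
  rw [integrable_prod_iff hmeas]
  constructor
  · filter_upwards [ae_restrict_mem measurableSet_Ioi] with a ha
    refine Integrable.of_integral_ne_zero ?_
    rw [integral_gamma_kernel hr ha]
    exact (Real.exp_pos _).ne'
  · have hexp : IntegrableOn (fun a : ℝ => Real.exp (-(1 + Real.log r) * a)) (Ioi 0) :=
      exp_neg_integrableOn_Ioi 0 hlog
    refine hexp.congr_fun (fun a ha => ?_) measurableSet_Ioi
    refine (integral_gamma_kernel hr ha).symm.trans ?_
    refine setIntegral_congr_fun measurableSet_Ioi fun u hu => ?_
    have h₁ := Real.rpow_nonneg (le_of_lt hu) (a - 1)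
    have h₂ := Real.Gamma_pos_of_pos ha
    exact (Real.norm_of_nonneg (by positivity)).symm

end GammaKernel

/-- For every `s > 0`,
`∫_0^∞ e^(-s u) e^(-u) φ(e^(-1) u)/u du = 1/(1 + log(1+s))`:
`u ↦ (e^(-u)/u) φ(e^(-1) u)` is the probability density whose Laplace transform is
`1/log(e (1+s))`. -/
theorem stmt_9 (s : ℝ) (hs : 0 < s) :
    ∫ u in Set.Ioi (0:ℝ),
        Real.exp (-s * u) * Real.exp (-u) * fransenWrigge (Real.exp (-1) * u) / u
      = 1 / (1 + Real.log (1 + s)) := by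
  have hr : (0:ℝ) < 1 + s := by linarith
  have hlog : 0 < 1 + Real.log (1 + s) := by
    have := Real.log_pos (by linarith : 1 < 1 + s)
    linarith
  calc
    _ = ∫ u in Set.Ioi (0:ℝ), ∫ a in Set.Ioi (0:ℝ),
          u ^ (a - 1) * Real.exp (-((1 + s) * u)) * (Real.exp (-a) / Real.Gamma a) := by
      refine setIntegral_congr_fun measurableSet_Ioi fun u hu => ?_
      have hu : 0 < u := hu
      simp only [fransenWrigge]
      rw [mul_div_right_comm, ← integral_const_mul]
      refine setIntegral_congr_fun measurableSet_Ioi fun a ha => ?_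
      rw [Real.mul_rpow (Real.exp_pos _).le hu.le, ← Real.exp_mul, ← Real.exp_add,
        Real.rpow_sub_one hu.ne', neg_one_mul,
        show -s * u + -u = -((1 + s) * u) by ring]
      ring
    _ = ∫ a in Set.Ioi (0:ℝ), ∫ u in Set.Ioi (0:ℝ),
          u ^ (a - 1) * Real.exp (-((1 + s) * u)) * (Real.exp (-a) / Real.Gamma a) :=
      (integral_integral_swap (integrable_gamma_kernel hr hlog)).symm
    _ = ∫ a in Set.Ioi (0:ℝ), Real.exp (-(1 + Real.log (1 + s)) * a) :=
      setIntegral_congr_fun measurableSet_Ioi fun a ha => integral_gamma_kernel hr ha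
    _ = 1 / (1 + Real.log (1 + s)) := by
      rw [integral_exp_mul_Ioi (by linarith) 0]
      rw [mul_zero, Real.exp_zero, neg_div_neg_eq]
end

section
/- Let a > 0, let γ be the Euler–Mascheroni constant, and define f : ℝ → ℝ by f(u) = 0 for u ≤ 0, f(u) = e^(−γ·a)·u^(a−1)/Γ(a) for 0 < u ≤ 1, and f(u) = (e^(−γ·a)·u^(a−1)/Γ(a))·(1 − a·∫_1^u (η−1)^(a−1)·η^(−a) dη) for 1 < u < 2. Then f is differentiable on (0,1) ∪ (1,2) and satisfies the delay differential equation u·f′(u) + f(u) = a·( f(u) − f(u−1) ) for all u ∈ (0,1) ∪ (1,2). -/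
open MeasureTheory intervalIntegral

/-- The explicit piecewise density of the stationary shot noise with deterministic
amplitude `1` and parameter `a = Λ/B`: it vanishes for `u ≤ 0`, equals
`e^(-γ a) u^(a-1)/Γ(a)` for `0 < u ≤ 1`, and equals
`(e^(-γ a) u^(a-1)/Γ(a)) (1 - a ∫_1^u (η-1)^(a-1) η^(-a) dη)` for `1 < u` (the
theorem below only uses its values on `(0,1) ∪ (1,2)`). -/
noncomputable def shotNoiseDensity (a : ℝ) (u : ℝ) : ℝ :=
  if u ≤ 0 then 0
  else if u ≤ 1 then
    Real.exp (-Real.eulerMascheroniConstant * a) * u ^ (a - 1) / Real.Gamma a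
  else
    Real.exp (-Real.eulerMascheroniConstant * a) * u ^ (a - 1) / Real.Gamma a *
      (1 - a * ∫ η in (1:ℝ)..u, (η - 1) ^ (a - 1) * η ^ (-a))

theorem shotNoiseDensity_of_nonpos (a : ℝ) {u : ℝ} (hu : u ≤ 0) : shotNoiseDensity a u = 0 :=
  if_pos hu

theorem shotNoiseDensity_of_mem_Ioc (a : ℝ) {u : ℝ} (hu : u ∈ Set.Ioc (0:ℝ) 1) :
    shotNoiseDensity a u =
      Real.exp (-Real.eulerMascheroniConstant * a) * u ^ (a - 1) / Real.Gamma a := by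
  rw [shotNoiseDensity, if_neg hu.1.not_ge, if_pos hu.2]

theorem shotNoiseDensity_of_one_lt (a : ℝ) {u : ℝ} (hu : 1 < u) :
    shotNoiseDensity a u =
      Real.exp (-Real.eulerMascheroniConstant * a) * u ^ (a - 1) / Real.Gamma a *
        (1 - a * ∫ η in (1:ℝ)..u, (η - 1) ^ (a - 1) * η ^ (-a)) := by
  rw [shotNoiseDensity, if_neg (by linarith), if_neg hu.not_ge]

theorem intervalIntegrable_sub_one_rpow_mul_rpow {a u : ℝ} (ha : 0 < a) (hu : 1 < u) :
    IntervalIntegrable (fun η : ℝ => (η - 1) ^ (a - 1) * η ^ (-a)) volume 1 u := by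
  have h : IntervalIntegrable (fun η : ℝ => (η - 1) ^ (a - 1)) volume 1 u := by
    simpa using (intervalIntegrable_rpow' (a := 0) (b := u - 1) (r := a - 1)
      (by linarith)).comp_sub_right 1
  refine h.mul_continuousOn fun x hx => ?_
  rw [Set.uIcc_of_le hu.le] at hx
  exact (Real.continuousAt_rpow_const x (-a)
    (Or.inl (by linarith [hx.1]))).continuousWithinAt

theorem hasDerivAt_integral_sub_one_rpow_mul_rpow {a u : ℝ} (ha : 0 < a) (hu : 1 < u) :
    HasDerivAt (fun v : ℝ => ∫ η in (1:ℝ)..v, (η - 1) ^ (a - 1) * η ^ (-a))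
      ((u - 1) ^ (a - 1) * u ^ (-a)) u := by
  have hm : Measurable fun η : ℝ => (η - 1) ^ (a - 1) * η ^ (-a) := by fun_prop
  refine integral_hasDerivAt_right (intervalIntegrable_sub_one_rpow_mul_rpow ha hu)
    hm.stronglyMeasurable.stronglyMeasurableAtFilter ?_
  exact ((continuousAt_id.sub continuousAt_const).rpow_const
    (Or.inl (sub_pos.2 hu).ne')).mul (Real.continuousAt_rpow_const u (-a) (Or.inl (by linarith)))

theorem hasDerivAt_exp_mul_rpow_div_Gamma (a : ℝ) {u : ℝ} (hu : 0 < u) :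
    HasDerivAt
      (fun v : ℝ => Real.exp (-Real.eulerMascheroniConstant * a) * v ^ (a - 1) / Real.Gamma a)
      (Real.exp (-Real.eulerMascheroniConstant * a) * ((a - 1) * u ^ (a - 1 - 1)) /
        Real.Gamma a) u :=
  ((Real.hasDerivAt_rpow_const (Or.inl hu.ne')).const_mul _).div_const _

/-- The density `f = shotNoiseDensity a` is differentiable on `(0,1) ∪ (1,2)` and
satisfies the delay differential equation `u f'(u) + f(u) = a (f(u) - f(u-1))`
there. -/
theorem stmt_11 (a : ℝ) (ha : 0 < a) :
    ∀ u ∈ Set.Ioo (0:ℝ) 1 ∪ Set.Ioo (1:ℝ) 2,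
      DifferentiableAt ℝ (shotNoiseDensity a) u ∧
      u * deriv (shotNoiseDensity a) u + shotNoiseDensity a u
        = a * (shotNoiseDensity a u - shotNoiseDensity a (u - 1)) := by
  rintro u (⟨h0, h1⟩ | ⟨h1, h2⟩)
  · have hd := (hasDerivAt_exp_mul_rpow_div_Gamma a h0).congr_of_eventuallyEq
      (Filter.eventually_of_mem (Ioo_mem_nhds h0 h1) fun v hv =>
        shotNoiseDensity_of_mem_Ioc a ⟨hv.1, hv.2.le⟩)
    refine ⟨hd.differentiableAt, ?_⟩
    rw [hd.deriv, shotNoiseDensity_of_mem_Ioc a ⟨h0, h1.le⟩,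
      shotNoiseDensity_of_nonpos a (by linarith), Real.rpow_sub_one h0.ne' (a - 1)]
    field_simp
    ring
  · have h0 : 0 < u := by linarith
    have hd := ((hasDerivAt_exp_mul_rpow_div_Gamma a h0).mul
      (((hasDerivAt_integral_sub_one_rpow_mul_rpow ha h1).const_mul a).const_sub
        1)).congr_of_eventuallyEq
      (Filter.eventually_of_mem (Ioi_mem_nhds h1) fun v hv => shotNoiseDensity_of_one_lt a hv)
    refine ⟨hd.differentiableAt, ?_⟩
    have hpow : u * (u ^ (a - 1) * u ^ (-a)) = 1 := by
      rw [Real.rpow_sub_one h0.ne', Real.rpow_neg h0.le]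
      have := (Real.rpow_pos_of_pos h0 a).ne'
      field_simp
    rw [hd.deriv, shotNoiseDensity_of_one_lt a h1,
      shotNoiseDensity_of_mem_Ioc a ⟨by linarith, by linarith⟩]
    have hpow' : u * u ^ (a - 1 - 1) = u ^ (a - 1) := by
      rw [Real.rpow_sub_one h0.ne' (a - 1)]
      field_simp
    generalize (∫ η in (1:ℝ)..u, (η - 1) ^ (a - 1) * η ^ (-a)) = I
    linear_combination
      Real.exp (-Real.eulerMascheroniConstant * a) / Real.Gamma a * (a - 1) * (1 - a * I) * hpow' -
        a * Real.exp (-Real.eulerMascheroniConstant * a) / Real.Gamma a * (u - 1) ^ (a - 1) * hpow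
end

section
/- For β > −1 and αp real with αp + x > 0 on the domain of integration, define the two-parameter Volterra function μ(z, β, αp) = ∫_0^∞ z^(αp+x) · x^β / (Γ(β+1)·Γ(αp+x+1)) dx for z > 0. Then for every u > 0, ∫_0^∞ e^(−2a−u) · ( Σ_{k=0}^∞ a^k · u^(a+k−1) / (Γ(k+1)·Γ(a+k)) ) da = e^(−u−2) · Σ_{k=0}^∞ e^(2k) · μ(e^(−2)·u, k, k−1). (The integrand in a equals e^(−2a)·e^(−(a+u))·(u/a)^((a−1)/2)·I_{a−1}(2√(a·u)), the Gamma(2,β=2)-amplitude shot noise density with parameter a mixed against the exponential law of A.) -/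
open MeasureTheory

/-- The two-parameter Volterra function
`μ(z, β, αp) = ∫_0^∞ z^(αp+x) x^β / (Γ(β+1) Γ(αp+x+1)) dx`. -/
noncomputable def volterraMu2 (z β αp : ℝ) : ℝ :=
  ∫ x in Set.Ioi (0:ℝ), z ^ (αp + x) * x ^ β / (Real.Gamma (β + 1) * Real.Gamma (αp + x + 1))

/-- A Gamma function lower bound, from restricting the Euler integral to `[u, u + 1]`. -/
theorem rpow_mul_exp_le_Gamma {u s : ℝ} (hu : 0 < u) (hs : 1 ≤ s) :
    u ^ (s - 1) * Real.exp (-(u + 1)) ≤ Real.Gamma s := by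
  have hconv := Real.GammaIntegral_convergent (zero_lt_one.trans_le hs)
  have hsub : Set.Ioc u (u + 1) ⊆ Set.Ioi 0 := fun t ht => hu.trans ht.1
  rw [Real.Gamma_eq_integral (zero_lt_one.trans_le hs)]
  calc u ^ (s - 1) * Real.exp (-(u + 1))
      = ∫ _ in Set.Ioc u (u + 1), u ^ (s - 1) * Real.exp (-(u + 1)) := by simp
    _ ≤ ∫ t in Set.Ioc u (u + 1), Real.exp (-t) * t ^ (s - 1) := by
        refine setIntegral_mono_on (integrableOn_const (by simp)) (hconv.mono_set hsub) measurableSet_Ioc ?_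
        intro t ht
        rw [mul_comm]
        have h1 : Real.exp (-(u + 1)) ≤ Real.exp (-t) := Real.exp_le_exp.2 (by linarith [ht.2])
        have h2 : u ^ (s - 1) ≤ t ^ (s - 1) :=
          Real.rpow_le_rpow hu.le ht.1.le (by linarith)
        have h3 : 0 ≤ u ^ (s - 1) := Real.rpow_nonneg hu.le _
        gcongr
    _ ≤ ∫ t in Set.Ioi (0:ℝ), Real.exp (-t) * t ^ (s - 1) := by
        refine setIntegral_mono_set hconv ?_ hsub.eventuallyLE
        filter_upwards [ae_restrict_mem measurableSet_Ioi] with t ht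
        exact mul_nonneg (Real.exp_nonneg _) (Real.rpow_nonneg (le_of_lt ht) _)

theorem rpow_div_Gamma_le {u s : ℝ} (hu : 0 < u) (hs : 0 < s) :
    u ^ (s - 1) / Real.Gamma s ≤ Real.exp (u + 1) * (1 + u⁻¹) := by
  have hG := Real.Gamma_pos_of_pos hs
  have hE : Real.exp (u + 1) * Real.exp (-(u + 1)) = 1 := by
    rw [← Real.exp_add]; simp
  have hEpos := Real.exp_pos (u + 1)
  have hui := inv_pos.2 hu
  rw [div_le_iff₀ hG]
  rcases le_total 1 s with h | h
  · have := mul_le_mul_of_nonneg_left (rpow_mul_exp_le_Gamma hu h) hEpos.le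
    have h2 : 0 ≤ Real.exp (u + 1) * u⁻¹ * Real.Gamma s := by positivity
    linear_combination this + h2 - u ^ (s - 1) * hE
  · have key := rpow_mul_exp_le_Gamma (s := s + 1) hu (by linarith)
    rw [Real.Gamma_add_one hs.ne', add_sub_cancel_right] at key
    have key' : u ^ s * Real.exp (-(u + 1)) ≤ Real.Gamma s :=
      key.trans (mul_le_of_le_one_left hG.le h)
    have hus : u⁻¹ * u ^ s = u ^ (s - 1) := by
      rw [Real.rpow_sub_one hu.ne', div_eq_mul_inv, mul_comm]
    have := mul_le_mul_of_nonneg_left key' (mul_pos hEpos hui).le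
    have h2 : 0 ≤ Real.exp (u + 1) * Real.Gamma s := by positivity
    linear_combination this + h2 - u ^ (s - 1) * hE -
      Real.exp (u + 1) * Real.exp (-(u + 1)) * hus

theorem integrableOn_pow_mul_exp_neg_two_mul (k : ℕ) :
    IntegrableOn (fun a : ℝ => a ^ k * Real.exp (-2 * a)) (Set.Ioi 0) := by
  have h := integrableOn_rpow_mul_exp_neg_mul_rpow (s := k) (p := 1) (b := 2)
    (by linarith [k.cast_nonneg (α := ℝ)]) one_pos two_pos
  simpa using h

theorem integral_pow_mul_exp_neg_two_mul (k : ℕ) :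
    ∫ a in Set.Ioi (0:ℝ), a ^ k * Real.exp (-2 * a) = Real.Gamma (k + 1) * (1 / 2) ^ (k + 1) := by
  have h := Real.integral_rpow_mul_exp_neg_mul_Ioi (a := k + 1) (r := 2) (by positivity) two_pos
  rw [mul_comm, ← Real.rpow_natCast (1 / 2 : ℝ) (k + 1), Nat.cast_add_one, ← h]
  simp

/-- Mixing the Gamma(shape 2)-amplitude shot-noise density
`e^(-(a+u)) (u/a)^((a-1)/2) I_{a-1}(2√(a u))
  = e^(-(a+u)) Σ_k a^k u^(a+k-1)/(Γ(k+1) Γ(a+k))`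
against the exponential law of the parameter `A` gives
`e^(-u-2) Σ_k e^(2k) μ(e^(-2) u, k, k-1)` in terms of Volterra functions. -/
theorem stmt_12 (u : ℝ) (hu : 0 < u) :
    ∫ a in Set.Ioi (0:ℝ),
        Real.exp (-2 * a - u) *
          ∑' k : ℕ, a ^ k * u ^ (a + k - 1) / (Real.Gamma (k + 1) * Real.Gamma (a + k))
      = Real.exp (-u - 2) *
          ∑' k : ℕ, Real.exp (2 * k) * volterraMu2 (Real.exp (-2) * u) k ((k : ℝ) - 1) := by
  set F : ℕ → ℝ → ℝ := fun k a => Real.exp (-2 * a - u) *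
    (a ^ k * u ^ (a + k - 1) / (Real.Gamma (k + 1) * Real.Gamma (a + k))) with hF
  set D : ℝ := Real.exp (-u) * (Real.exp (u + 1) * (1 + u⁻¹)) with hD
  have hGk (k : ℕ) : 0 < Real.Gamma (k + 1) := Real.Gamma_pos_of_pos (by positivity)
  have hbound (k : ℕ) (a : ℝ) (ha : a ∈ Set.Ioi (0:ℝ)) :
      ‖F k a‖ ≤ D / Real.Gamma (k + 1) * (a ^ k * Real.exp (-2 * a)) := by
    have ha : 0 < a := ha
    have hak : 0 < a + k := by positivity
    have hG := Real.Gamma_pos_of_pos hak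
    have hGk := hGk k
    have hp := Real.rpow_pos_of_pos hu (a + k - 1)
    rw [Real.norm_of_nonneg (by positivity)]
    calc F k a = (Real.exp (-u) / Real.Gamma (k + 1) * (a ^ k * Real.exp (-2 * a))) *
          (u ^ (a + k - 1) / Real.Gamma (a + k)) := by
          simp only [hF]
          rw [sub_eq_add_neg, Real.exp_add]
          field_simp
      _ ≤ (Real.exp (-u) / Real.Gamma (k + 1) * (a ^ k * Real.exp (-2 * a))) *
          (Real.exp (u + 1) * (1 + u⁻¹)) := by
          gcongr
          exact rpow_div_Gamma_le hu hak
      _ = _ := by rw [hD]; ring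
  have hmeas (k : ℕ) : AEStronglyMeasurable (F k) (volume.restrict (Set.Ioi 0)) := by
    refine ContinuousOn.aestronglyMeasurable ?_ measurableSet_Ioi
    intro a ha
    have ha : 0 < a := ha
    have hak : 0 < a + k := by positivity
    have hcG : ContinuousAt (fun a : ℝ => Real.Gamma (a + k)) a :=
      ContinuousAt.comp (f := fun a : ℝ => a + k) (g := Real.Gamma)
        (Real.differentiableAt_Gamma fun m => by
          have : (0:ℝ) ≤ m := m.cast_nonneg
          linarith).continuousAt (by fun_prop)
    have hne : Real.Gamma (k + 1) * Real.Gamma (a + k) ≠ 0 :=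
      (mul_pos (hGk k) (Real.Gamma_pos_of_pos hak)).ne'
    have hcu : ContinuousAt (fun a : ℝ => u ^ (a + k - 1)) a :=
      ContinuousAt.rpow continuousAt_const (by fun_prop) (Or.inl hu.ne')
    have hce : ContinuousAt (fun a : ℝ => Real.exp (-2 * a - u)) a := by fun_prop
    exact (hce.mul (((continuousAt_id.pow k).mul hcu).div
      (continuousAt_const.mul hcG) hne)).continuousWithinAt
  have hdom (k : ℕ) := (integrableOn_pow_mul_exp_neg_two_mul k).const_mul (D / Real.Gamma (k + 1))
  have hae (k : ℕ) := (ae_restrict_mem (μ := volume) measurableSet_Ioi).mono (hbound k)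
  have hint (k : ℕ) : Integrable (F k) (volume.restrict (Set.Ioi 0)) :=
    (hdom k).mono' (hmeas k) (hae k)
  have hsum : Summable fun k => ∫ a in Set.Ioi (0:ℝ), ‖F k a‖ := by
    have hgeom : Summable fun k : ℕ => D * (1 / 2 : ℝ) ^ (k + 1) :=
      ((summable_nat_add_iff 1).2 summable_geometric_two).mul_left D
    refine hgeom.of_nonneg_of_le (fun k => integral_nonneg fun a => norm_nonneg _) fun k => ?_
    refine (integral_mono_ae (hint k).norm (hdom k) (hae k)).trans_eq ?_
    rw [integral_const_mul, integral_pow_mul_exp_neg_two_mul]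
    have := (hGk k).ne'
    field_simp
  simp_rw [← tsum_mul_left]
  rw [← integral_tsum_of_summable_integral_norm hint hsum]
  refine tsum_congr fun k => ?_
  rw [volterraMu2, ← integral_const_mul, ← integral_const_mul]
  refine setIntegral_congr_fun measurableSet_Ioi fun x _ => ?_
  have hexp : Real.exp (-2 * x - u) = Real.exp (-u - 2) *
      (Real.exp (2 * k) * Real.exp (-2 * ((k : ℝ) - 1 + x))) := by
    rw [← Real.exp_add, ← Real.exp_add]
    ring_nf
  simp only [hF]
  rw [Real.mul_rpow (Real.exp_nonneg _) hu.le, ← Real.exp_mul, Real.rpow_natCast, hexp,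
    show (k : ℝ) - 1 + x + 1 = x + k by ring, show (k : ℝ) - 1 + x = x + k - 1 by ring]
  ring
end

section
/- For every real s > 0, ∫_0^s (1 − (1 + ξ²)^(−1/2)) / ξ dξ = ln( (1 + √(1 + s²)) / 2 ). Consequently, for Laplace-type amplitudes with Fourier transform w̃(ξ) = (1+ξ²)^(−1/2) (case β = 1/2) and Gamma(α)-distributed parameter A, the transform of the stationary shot noise is 1 / (1 + ln((1+√(1+s²))/2) )^α. -/
open MeasureTheory intervalIntegral

/-- Rationalizing the numerator; both sides vanish at `x = 0`. -/
lemma one_sub_rpow_neg_half_div_eq (x : ℝ) :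
    (1 - (1 + x ^ 2) ^ (-(1/2 : ℝ))) / x
      = x / (Real.sqrt (1 + x ^ 2) * (1 + Real.sqrt (1 + x ^ 2))) := by
  have hpos : 0 < 1 + x ^ 2 := by positivity
  have hsq : Real.sqrt (1 + x ^ 2) ^ 2 = 1 + x ^ 2 := Real.sq_sqrt hpos.le
  have hr : 0 < Real.sqrt (1 + x ^ 2) := Real.sqrt_pos.2 hpos
  rw [Real.rpow_neg hpos.le, ← Real.sqrt_eq_rpow]
  rcases eq_or_ne x 0 with rfl | hx
  · simp
  · field_simp
    linear_combination hsq

lemma hasDerivAt_log_one_add_sqrt_half (x : ℝ) :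
    HasDerivAt (fun x : ℝ => Real.log ((1 + Real.sqrt (1 + x ^ 2)) / 2))
      (x / (Real.sqrt (1 + x ^ 2) * (1 + Real.sqrt (1 + x ^ 2)))) x := by
  have hpos : 0 < 1 + x ^ 2 := by positivity
  have hr : 0 < Real.sqrt (1 + x ^ 2) := Real.sqrt_pos.2 hpos
  have h := (((((hasDerivAt_pow 2 x).const_add 1).sqrt hpos.ne').const_add 1).div_const 2).log
    (by positivity)
  convert h using 1
  push_cast
  field_simp

lemma integral_one_sub_rpow_neg_half_div (s : ℝ) :
    ∫ ξ in (0:ℝ)..s, (1 - (1 + ξ ^ 2) ^ (-(1/2 : ℝ))) / ξ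
      = Real.log ((1 + Real.sqrt (1 + s ^ 2)) / 2) := by
  simp_rw [one_sub_rpow_neg_half_div_eq]
  have hcont : Continuous fun x : ℝ =>
      x / (Real.sqrt (1 + x ^ 2) * (1 + Real.sqrt (1 + x ^ 2))) :=
    continuous_id.div (by fun_prop) fun x => by positivity
  rw [integral_eq_sub_of_hasDerivAt (fun x _ => hasDerivAt_log_one_add_sqrt_half x)
    (hcont.intervalIntegrable 0 s)]
  norm_num

/-- For every `s > 0`,
`∫_0^s (1 - (1+ξ²)^(-1/2))/ξ dξ = log((1 + √(1+s²))/2)`; consequently, for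
Laplace-type amplitudes with Fourier transform `(1+ξ²)^(-1/2)` (`β = 1/2`) and
Gamma(α)-distributed parameter, the shot-noise transform is
`1/(1 + log((1+√(1+s²))/2))^α`. -/
theorem stmt_14 (s : ℝ) (hs : 0 < s) :
    (∫ ξ in (0:ℝ)..s, (1 - (1 + ξ ^ 2) ^ (-(1/2 : ℝ))) / ξ
      = Real.log ((1 + Real.sqrt (1 + s ^ 2)) / 2)) ∧
    ∀ α : ℝ, 0 < α →
      1 / (1 + ∫ ξ in (0:ℝ)..s, (1 - (1 + ξ ^ 2) ^ (-(1/2 : ℝ))) / ξ) ^ α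
        = 1 / (1 + Real.log ((1 + Real.sqrt (1 + s ^ 2)) / 2)) ^ α := by
  refine ⟨integral_one_sub_rpow_neg_half_div s, fun α _ => ?_⟩
  rw [integral_one_sub_rpow_neg_half_div]
end
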